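/- Theorem (arbitrarily many sequential detections for the cluster state): For every integer N ≥ 3 and every natural number n, there exist sharpness parameters λ_1, …, λ_n ∈ (0,1) such that, setting ρ_1 = |C_N⟩⟨C_N| and ρ_k = (id ⊗ Φ_{λ_{k−1}})(ρ_{k−1}) for 2 ≤ k ≤ n (the map acting on the N-th qubit), one has Tr(W_C^{λ_k} ρ_k) < 0 for every k = 1, …, n; i.e., all n sequential observers detect genuine multipartite entanglement of the cluster state. -/

import Mathlib

open Matrix
open scoped ComplexOrder

noncomputable section

/-- The space of operators on `N` qubits: complex `2^N × 2^N` matrices, with the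
`N`-fold tensor-product structure made explicit by indexing rows and columns by
functions `Fin N → Fin 2`. -/
abbrev QM (N : ℕ) := Matrix (Fin N → Fin 2) (Fin N → Fin 2) ℂ

/-- The Pauli matrix σ_x. -/
def sigx : Matrix (Fin 2) (Fin 2) ℂ := !![0, 1; 1, 0]

/-- The Pauli matrix σ_z. -/
def sigz : Matrix (Fin 2) (Fin 2) ℂ := !![1, 0; 0, -1]

/-- The tensor (Kronecker) product `f 0 ⊗ f 1 ⊗ ⋯ ⊗ f (N-1)` of single-qubit operators. -/
def tensorAll (N : ℕ) (f : Fin N → Matrix (Fin 2) (Fin 2) ℂ) : QM N :=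
  Matrix.of fun v w => ∏ i, f i (v i) (w i)

/-- The single-qubit operator `M` acting on qubit `m`, tensored with the identity
on all other qubits. -/
def site (N : ℕ) (m : Fin N) (M : Matrix (Fin 2) (Fin 2) ℂ) : QM N :=
  tensorAll N (fun i => if i = m then M else 1)

/-- Cluster-state stabilizer generator (0-based index `m : Fin N`): σ_x on qubit `m`
and σ_z on its nearest neighbour(s); it represents the 1-based generator `S_{m+1}`. -/
def clS (N : ℕ) (m : Fin N) : QM N :=
  tensorAll N (fun i =>
    if i = m then sigx
    else if i.val + 1 = m.val ∨ m.val + 1 = i.val then sigz else 1)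

/-- Factor `(I + S_{m+1})/2` of the cluster witness. -/
def clFactor (N : ℕ) (m : Fin N) : QM N := (1/2 : ℂ) • ((1 : QM N) + clS N m)

/-- Factor of the modified cluster witness: `(I + λ S_N)/2` for the last generator and
`(I + S_{m+1})/2` otherwise. -/
def clFactorMod (N : ℕ) (lam : ℝ) (m : Fin N) : QM N :=
  if m.val = N - 1 then (1/2 : ℂ) • ((1 : QM N) + (lam : ℂ) • clS N m)
  else (1/2 : ℂ) • ((1 : QM N) + clS N m)

/-- Product of the cluster-witness factors over the 1-based indices `m+1` of parity
`r` (`r = 1` gives the even 1-based indices, `r = 0` the odd ones); the factors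
pairwise commute, so the list ordering is immaterial. -/
def clProd (N : ℕ) (r : ℕ) : QM N :=
  (((List.finRange N).filter (fun m => m.val % 2 = r)).map (clFactor N)).prod

/-- The analogous parity product for the modified cluster witness; the factor carrying
`λ` (the one for `S_N`) lies in the even product when `N` is even and in the odd one
when `N` is odd. -/
def clProdMod (N : ℕ) (lam : ℝ) (r : ℕ) : QM N :=
  (((List.finRange N).filter (fun m => m.val % 2 = r)).map (clFactorMod N lam)).prod

/-- The cluster-state genuine-multipartite-entanglement witness
`W_C = 3 I − 2 [∏_{even m}(I+S_m)/2 + ∏_{odd m}(I+S_m)/2]`. -/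
def clWitness (N : ℕ) : QM N :=
  (3 : ℂ) • (1 : QM N) - (2 : ℂ) • (clProd N 1 + clProd N 0)

/-- The modified (unsharp) cluster witness `W_C^λ`, obtained from `W_C` by replacing
the factor `(I+S_N)/2` by `(I+λS_N)/2`. -/
def clWitnessMod (N : ℕ) (lam : ℝ) : QM N :=
  (3 : ℂ) • (1 : QM N) - (2 : ℂ) • (clProdMod N lam 1 + clProdMod N lam 0)

/-- The controlled-Z gate acting on qubits `a` and `b` of an `N`-qubit system:
the diagonal unitary acting as `−1` on `|1⟩_a|1⟩_b` and `+1` on the other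
computational basis states, tensored with the identity elsewhere. -/
def czGate (N : ℕ) (a b : Fin N) : QM N :=
  Matrix.of fun v w =>
    if v = w then (if v a = 1 ∧ v b = 1 then (-1 : ℂ) else 1) else 0

/-- The state `|+⟩^{⊗N}`. -/
def plusAll (N : ℕ) : (Fin N → Fin 2) → ℂ := fun _ => ((1 / Real.sqrt 2 : ℝ) : ℂ) ^ N

/-- The `N`-qubit linear cluster state `|C_N⟩ = (∏_{m=1}^{N-1} CZ_{m,m+1}) |+⟩^{⊗N}`
(the CZ gates pairwise commute, so the ordering is immaterial). -/
def clusterVec (N : ℕ) : (Fin N → Fin 2) → ℂ :=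
  (((List.finRange (N - 1)).map (fun i =>
      czGate N ⟨i.val, by have := i.isLt; omega⟩ ⟨i.val + 1, by have := i.isLt; omega⟩)).prod)
    *ᵥ plusAll N

/-- The rank-one projector `|ψ⟩⟨ψ|` onto a vector `ψ`. -/
def outer (N : ℕ) (ψ : (Fin N → Fin 2) → ℂ) : QM N :=
  Matrix.vecMulVec ψ (star ψ)

/-- The single-qubit unsharp-measurement channel
`Φ_λ(ρ) = ((2+√(1−λ²))/4)ρ + (1/4)σ_z ρ σ_z + ((1−√(1−λ²))/4)σ_x ρ σ_x`, applied to
qubit `m` of an `N`-qubit operator (and acting as the identity on the other qubits). -/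
def phiMap (N : ℕ) (m : Fin N) (lam : ℝ) (ρ : QM N) : QM N :=
  (((2 + Real.sqrt (1 - lam ^ 2)) / 4 : ℝ) : ℂ) • ρ
    + (1/4 : ℂ) • (site N m sigz * ρ * site N m sigz)
    + (((1 - Real.sqrt (1 - lam ^ 2)) / 4 : ℝ) : ℂ) • (site N m sigx * ρ * site N m sigx)


/-! Auxiliary lemmas -/

theorem aux_tensor_mul (N : ℕ) (f g : Fin N → Matrix (Fin 2) (Fin 2) ℂ) :
    tensorAll N f * tensorAll N g = tensorAll N (fun i => f i * g i) := by
  ext v w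
  simp only [tensorAll, Matrix.mul_apply, Matrix.of_apply]
  rw [Finset.prod_univ_sum]
  simp [Finset.prod_mul_distrib]

theorem aux_tensor_one (N : ℕ) :
    tensorAll N (fun _ => 1) = 1 := by
  ext v w
  simp only [tensorAll, Matrix.of_apply, Matrix.one_apply]
  rw [Finset.prod_ite_zero]
  simp [funext_iff]

theorem aux_site_comm (N : ℕ) (m : Fin N) (A : Matrix (Fin 2) (Fin 2) ℂ) (c : ℂ)
    (g : Fin N → Matrix (Fin 2) (Fin 2) ℂ) (h : A * g m = c • (g m * A)) :
    site N m A * tensorAll N g = c • (tensorAll N g * site N m A) := by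
  unfold site
  rw [aux_tensor_mul, aux_tensor_mul]
  ext v w
  simp only [tensorAll, Matrix.of_apply, Matrix.smul_apply, smul_eq_mul]
  rw [← Finset.mul_prod_erase _ _ (Finset.mem_univ m),
    ← Finset.mul_prod_erase (Finset.univ) (fun i => (g i * if i = m then A else 1) (v i) (w i))
      (Finset.mem_univ m), ← mul_assoc]
  congr 1
  · simp [h]
  · apply Finset.prod_congr rfl
    intro i hi
    simp [Finset.ne_of_mem_erase hi]

theorem aux_site_sq (N : ℕ) (m : Fin N) (A : Matrix (Fin 2) (Fin 2) ℂ) (h : A * A = 1) :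
    site N m A * site N m A = 1 := by
  unfold site
  rw [aux_tensor_mul, ← aux_tensor_one]
  congr 1
  funext i
  split_ifs <;> simp [h]

theorem aux_xx : sigx * sigx = 1 := by
  ext i j; fin_cases i <;> fin_cases j <;> simp [sigx, Matrix.mul_apply]
theorem aux_zz : sigz * sigz = 1 := by
  ext i j; fin_cases i <;> fin_cases j <;> simp [sigz, Matrix.mul_apply]
theorem aux_xz : sigx * sigz = (-1 : ℂ) • (sigz * sigx) := by
  ext i j; fin_cases i <;> fin_cases j <;> simp [sigx, sigz, Matrix.mul_apply]
theorem aux_zx : sigz * sigx = (-1 : ℂ) • (sigx * sigz) := by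
  ext i j; fin_cases i <;> fin_cases j <;> simp [sigx, sigz, Matrix.mul_apply]

/-- Bookkeeping invariant of the sequence of states. -/
def AuxInv (M : ℕ) (ρ : QM (M + 2)) (p q : ℝ) : Prop :=
  (∀ m : Fin (M + 2), m.val < M → ρ * clS (M + 2) m = ρ) ∧ ρ.trace = 1 ∧
    (ρ * clS (M + 2) (Fin.last M).castSucc).trace = (p : ℂ) ∧
    (ρ * clS (M + 2) (Fin.last (M + 1))).trace = (q : ℂ)

theorem aux_conj_fix {N : ℕ} (ρ Z S : QM N) (h : ρ * S = ρ) (hc : Z * S = S * Z) :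
    (Z * ρ * Z) * S = Z * ρ * Z := by
  rw [mul_assoc, hc, ← mul_assoc, mul_assoc Z, h]

theorem aux_conj_trace {N : ℕ} (ρ Z S : QM N) (c : ℂ) (h : Z * Z = 1)
    (hc : Z * S = c • (S * Z)) :
    ((Z * ρ * Z) * S).trace = c * (ρ * S).trace := by
  rw [mul_assoc, hc, Matrix.mul_smul, Matrix.trace_smul, smul_eq_mul, Matrix.trace_mul_comm,
    ← mul_assoc, mul_assoc S, h, mul_one, Matrix.trace_mul_comm]

theorem aux_conj_trace_one {N : ℕ} (ρ Z : QM N) (h : Z * Z = 1) :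
    (Z * ρ * Z).trace = ρ.trace := by
  have := aux_conj_trace ρ Z 1 1 h (by simp)
  simpa using this

theorem aux_inv_step (M : ℕ) (ρ : QM (M + 2)) (p q lam : ℝ) (h : AuxInv M ρ p q) :
    AuxInv M (phiMap (M + 2) (Fin.last (M + 1)) lam ρ)
      ((1 + Real.sqrt (1 - lam ^ 2)) / 2 * p) (q / 2) := by
  obtain ⟨h1, h2, h3, h4⟩ := h
  have hz := aux_site_sq (M + 2) (Fin.last (M + 1)) sigz aux_zz
  have hx := aux_site_sq (M + 2) (Fin.last (M + 1)) sigx aux_xx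
  have hne : Fin.last (M + 1) ≠ (Fin.last M).castSucc := by
    intro h; have := congrArg Fin.val h; simp at this
  refine ⟨?_, ?_, ?_, ?_⟩
  · intro m hm
    have hne : Fin.last (M + 1) ≠ m := by
      intro h; rw [← h] at hm; simp at hm
    have key : ∀ A : Matrix (Fin 2) (Fin 2) ℂ, site (M + 2) (Fin.last (M + 1)) A * clS (M + 2) m
        = clS (M + 2) m * site (M + 2) (Fin.last (M + 1)) A := by
      intro A
      have := aux_site_comm (M + 2) (Fin.last (M + 1)) A 1 (fun i =>
        if i = m then sigx
        else if i.val + 1 = m.val ∨ m.val + 1 = i.val then sigz else 1) (by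
          rw [if_neg hne, if_neg (by simp; omega)]; simp)
      simpa [clS] using this
    unfold phiMap
    simp only [add_mul, Matrix.smul_mul]
    rw [h1 m hm, aux_conj_fix _ _ _ (h1 m hm) (key _), aux_conj_fix _ _ _ (h1 m hm) (key _)]
  · unfold phiMap
    simp only [Matrix.trace_add, Matrix.trace_smul]
    rw [aux_conj_trace_one _ _ hz, aux_conj_trace_one _ _ hx, h2]
    push_cast [smul_eq_mul]
    ring
  · have kz : site (M + 2) (Fin.last (M + 1)) sigz * clS (M + 2) (Fin.last M).castSucc
        = (1 : ℂ) • (clS (M + 2) (Fin.last M).castSucc * site (M + 2) (Fin.last (M + 1)) sigz) := by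
      apply aux_site_comm
      rw [if_neg hne, if_pos (by simp)]; simp
    have kx : site (M + 2) (Fin.last (M + 1)) sigx * clS (M + 2) (Fin.last M).castSucc
        = (-1 : ℂ) • (clS (M + 2) (Fin.last M).castSucc * site (M + 2) (Fin.last (M + 1)) sigx) := by
      apply aux_site_comm
      rw [if_neg hne, if_pos (by simp)]; exact aux_xz
    unfold phiMap
    simp only [add_mul, Matrix.smul_mul, Matrix.trace_add, Matrix.trace_smul]
    rw [aux_conj_trace _ _ _ _ hz kz, aux_conj_trace _ _ _ _ hx kx, h3]
    push_cast [smul_eq_mul]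
    ring
  · have kz : site (M + 2) (Fin.last (M + 1)) sigz * clS (M + 2) (Fin.last (M + 1))
        = (-1 : ℂ) • (clS (M + 2) (Fin.last (M + 1)) * site (M + 2) (Fin.last (M + 1)) sigz) := by
      apply aux_site_comm
      rw [if_pos rfl]; exact aux_zx
    have kx : site (M + 2) (Fin.last (M + 1)) sigx * clS (M + 2) (Fin.last (M + 1))
        = (1 : ℂ) • (clS (M + 2) (Fin.last (M + 1)) * site (M + 2) (Fin.last (M + 1)) sigx) := by
      apply aux_site_comm
      rw [if_pos rfl]; simp
    unfold phiMap
    simp only [add_mul, Matrix.smul_mul, Matrix.trace_add, Matrix.trace_smul]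
    rw [aux_conj_trace _ _ _ _ hz kz, aux_conj_trace _ _ _ _ hx kx, h4]
    push_cast [smul_eq_mul]
    ring

theorem aux_list_fix {N : ℕ} (ρ : QM N) (l : List (QM N)) (h : ∀ F ∈ l, ρ * F = ρ) :
    ρ * l.prod = ρ := by
  induction l with
  | nil => simp
  | cons a t ih =>
    rw [List.prod_cons, ← mul_assoc, h a (by simp), ih (fun F hF => h F (by simp [hF]))]

theorem aux_prod_trace (M : ℕ) (ρ : QM (M + 2)) (p q lam : ℝ) (h : AuxInv M ρ p q) (r : ℕ)
    (hr : r < 2) :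
    (ρ * clProdMod (M + 2) lam r).trace =
      if M % 2 = r then ((1 + (p : ℂ)) / 2) else (1 + (lam : ℂ) * q) / 2 := by
  obtain ⟨h1, h2, h3, h4⟩ := h
  unfold clProdMod
  rw [List.finRange_succ_last, List.finRange_succ_last]
  simp only [List.map_append, List.filter_append, List.prod_append, List.map_map]
  have key : ρ * (List.map (clFactorMod (M + 2) lam) (List.filter (fun m => decide (m.val % 2 = r))
      (List.map (Fin.castSucc ∘ Fin.castSucc) (List.finRange M)))).prod = ρ := by
    apply aux_list_fix
    intro F hF
    simp only [List.mem_map, List.mem_filter] at hF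
    obtain ⟨m, ⟨⟨mm, -, rfl⟩, -⟩, rfl⟩ := hF
    have hm := mm.isLt
    unfold clFactorMod
    rw [if_neg (by simp; omega), Matrix.mul_smul, mul_add, h1 _ (by simp), mul_one, ← two_smul ℂ ρ,
      smul_smul]
    norm_num
  rw [← mul_assoc, ← mul_assoc, key]
  by_cases hM : M % 2 = r
  · have hh : (M + 1) % 2 ≠ r := by omega
    have f1 : List.filter (fun m : Fin (M + 2) => decide (m.val % 2 = r)) [Fin.last (M + 1)] = [] := by
      simp [hh]
    have f2 : List.filter (fun m : Fin (M + 2) => decide (m.val % 2 = r))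
        (List.map Fin.castSucc [Fin.last M]) = [(Fin.last M).castSucc] := by
      simp [hM]
    simp only [List.map_cons, List.map_nil] at f2 ⊢
    rw [f1, f2, if_pos hM]
    simp only [List.map_cons, List.map_nil, List.prod_cons, List.prod_nil, mul_one]
    unfold clFactorMod
    rw [if_neg (by simp), Matrix.mul_smul, mul_add, Matrix.trace_smul, Matrix.trace_add, h3,
      mul_one, h2, smul_eq_mul]
    ring
  · have hh : (M + 1) % 2 = r := by omega
    have f1 : List.filter (fun m : Fin (M + 2) => decide (m.val % 2 = r)) [Fin.last (M + 1)] =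
        [Fin.last (M + 1)] := by
      simp [hh]
    have f2 : List.filter (fun m : Fin (M + 2) => decide (m.val % 2 = r))
        (List.map Fin.castSucc [Fin.last M]) = [] := by
      simp [hM]
    simp only [List.map_cons, List.map_nil] at f2 ⊢
    rw [f1, f2, if_neg hM]
    simp only [List.map_cons, List.map_nil, List.prod_cons, List.prod_nil, mul_one]
    unfold clFactorMod
    rw [if_pos (by simp), Matrix.mul_smul, mul_add, Matrix.mul_smul, Matrix.trace_smul,
      Matrix.trace_add, Matrix.trace_smul, h4, mul_one, h2, smul_eq_mul, smul_eq_mul]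
    ring

theorem aux_witness (M : ℕ) (ρ : QM (M + 2)) (p q lam : ℝ) (h : AuxInv M ρ p q) :
    (clWitnessMod (M + 2) lam * ρ).trace = ((1 - p - lam * q : ℝ) : ℂ) := by
  rw [Matrix.trace_mul_comm]
  unfold clWitnessMod
  have e0 := aux_prod_trace M ρ p q lam h 0 (by norm_num)
  have e1 := aux_prod_trace M ρ p q lam h 1 (by norm_num)
  rw [mul_sub, Matrix.mul_smul, Matrix.mul_smul, mul_add, Matrix.trace_sub, Matrix.trace_smul,
    Matrix.trace_smul, Matrix.trace_add, e0, e1, mul_one, h.2.1]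
  push_cast [smul_eq_mul]
  rcases Nat.mod_two_eq_zero_or_one M with hM | hM <;> simp [hM] <;> ring

/-- Sign of the cluster state in the computational basis. -/
def auxSign (M : ℕ) (v : Fin (M + 1) → Fin 2) : ℂ :=
  ∏ i : Fin M, if v i.castSucc = 1 ∧ v i.succ = 1 then (-1 : ℂ) else 1

theorem aux_list_diag {ι : Type*} [Fintype ι] [DecidableEq ι] {α : Type*} (l : List α)
    (d : α → ι → ℂ) :
    (l.map (fun a => Matrix.diagonal (d a))).prod = Matrix.diagonal (l.map d).prod := by
  induction l with
  | nil => simp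
  | cons a t ih => simp [ih]

theorem aux_clusterVec (M : ℕ) (v : Fin (M + 1) → Fin 2) :
    clusterVec (M + 1) v = auxSign M v * ((1 / Real.sqrt 2 : ℝ) : ℂ) ^ (M + 1) := by
  unfold clusterVec
  have : ∀ a b : Fin (M + 1), czGate (M + 1) a b = Matrix.diagonal
      (fun v => if v a = 1 ∧ v b = 1 then (-1 : ℂ) else 1) := by
    intro a b
    ext v w
    simp [czGate, Matrix.diagonal_apply]
  simp only [this]
  rw [aux_list_diag (List.finRange (M + 1 - 1)) (fun i (v : Fin (M + 1) → Fin 2) => if v ⟨i.val, by have := i.isLt; omega⟩ = 1 ∧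
    v ⟨i.val + 1, by have := i.isLt; omega⟩ = 1 then (-1 : ℂ) else 1), Matrix.mulVec_diagonal]
  unfold plusAll auxSign
  congr 1
  rw [← List.ofFn_eq_map, List.prod_ofFn, Finset.prod_apply]
  rfl

/-- Flip qubit `m`. -/
def auxFlip {N : ℕ} (m : Fin N) (v : Fin N → Fin 2) : Fin N → Fin 2 :=
  Function.update v m (1 - v m)

theorem aux_sign_flip (M : ℕ) (m : Fin (M + 1)) (v : Fin (M + 1) → Fin 2) :
    auxSign M (auxFlip m v) * ∏ j : Fin (M + 1),
      (if j.val + 1 = m.val ∨ m.val + 1 = j.val then sigz (v j) (v j) else 1) = auxSign M v := by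
  have e : ∏ j : Fin (M + 1),
      (if j.val + 1 = m.val ∨ m.val + 1 = j.val then sigz (v j) (v j) else 1) =
      (∏ j : Fin (M + 1), if j.val + 1 = m.val then sigz (v j) (v j) else 1) *
      ∏ j : Fin (M + 1), if m.val + 1 = j.val then sigz (v j) (v j) else 1 := by
    rw [← Finset.prod_mul_distrib]
    apply Finset.prod_congr rfl
    intro j _
    by_cases h1 : j.val + 1 = m.val
    · have : ¬ m.val + 1 = j.val := by omega
      simp [h1, this]
    · simp [h1]
  rw [e, Fin.prod_univ_castSucc, Fin.prod_univ_succ (fun j : Fin (M + 1) =>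
    if m.val + 1 = j.val then sigz (v j) (v j) else 1)]
  rw [if_neg (by simp; omega), if_neg (by simp), mul_one, one_mul]
  unfold auxSign
  rw [← Finset.prod_mul_distrib, ← Finset.prod_mul_distrib]
  apply Finset.prod_congr rfl
  intro i _
  have two : ∀ a : Fin 2, a = 0 ∨ a = 1 := by decide
  by_cases h1 : i.castSucc = m
  · subst h1
    have hne : i.succ ≠ i.castSucc := by
      intro h; have := congrArg Fin.val h; simp at this
    rcases two (v i.castSucc) with h | h <;> rcases two (v i.succ) with hh | hh <;>
      simp [auxFlip, Function.update_of_ne hne, h, hh, sigz]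
  · by_cases h2 : i.succ = m
    · subst h2
      rcases two (v i.castSucc) with h | h <;> rcases two (v i.succ) with hh | hh <;>
        simp [auxFlip, Function.update_of_ne h1, h, hh, sigz]
    · have hh1 : ¬ m.val = i.val := fun h => h1 (Fin.ext (by simp [h]))
      have hh2 : ¬ i.val + 1 = m.val := fun h => h2 (Fin.ext (by simp [h]))
      simp [auxFlip, Function.update_of_ne h1, Function.update_of_ne h2, hh1, hh2]

theorem aux_vec_fix (M : ℕ) (m : Fin (M + 1)) :
    clusterVec (M + 1) ᵥ* clS (M + 1) m = clusterVec (M + 1) := by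
  have two : ∀ a : Fin 2, a = 0 ∨ a = 1 := by decide
  funext w
  simp only [Matrix.vecMul, dotProduct]
  rw [Finset.sum_eq_single (auxFlip m w)]
  · rw [aux_clusterVec, aux_clusterVec, ← aux_sign_flip M m w, mul_right_comm]
    congr 2
    simp only [clS, tensorAll, Matrix.of_apply]
    apply Finset.prod_congr rfl
    intro j _
    by_cases h : j = m
    · subst h
      rcases two (w j) with h | h <;> simp [auxFlip, sigx, h]
    · simp only [if_neg h, auxFlip, Function.update_of_ne h]
      split_ifs <;> simp
  · intro v _ hv
    obtain ⟨i, hi⟩ := Function.ne_iff.mp hv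
    apply mul_eq_zero_of_right
    simp only [clS, tensorAll, Matrix.of_apply]
    apply Finset.prod_eq_zero (Finset.mem_univ i)
    by_cases h : i = m
    · subst h
      simp only [auxFlip, Function.update_self] at hi
      rcases two (w i) with h | h <;> rcases two (v i) with hh | hh <;>
        simp [sigx, h, hh] at hi ⊢
    · simp only [if_neg h, auxFlip, Function.update_of_ne h] at hi ⊢
      rcases two (w i) with h | h <;> rcases two (v i) with hh | hh <;> split_ifs <;>
        simp [sigz, h, hh] at hi ⊢
  · simp

theorem aux_sign_real (M : ℕ) (v : Fin (M + 1) → Fin 2) :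
    star (auxSign M v) = auxSign M v := by
  unfold auxSign
  rw [star_prod]
  apply Finset.prod_congr rfl
  intro i _
  split_ifs <;> simp

theorem aux_sign_sq (M : ℕ) (v : Fin (M + 1) → Fin 2) :
    auxSign M v * auxSign M v = 1 := by
  unfold auxSign
  rw [← Finset.prod_mul_distrib]
  apply Finset.prod_eq_one
  intro i _
  split_ifs <;> simp

theorem aux_star_vec (M : ℕ) : star (clusterVec (M + 1)) = clusterVec (M + 1) := by
  funext v
  rw [Pi.star_apply, aux_clusterVec, star_mul', aux_sign_real, star_pow]
  congr 2
  exact Complex.conj_ofReal _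

theorem aux_outer_trace (M : ℕ) : (outer (M + 1) (clusterVec (M + 1))).trace = 1 := by
  unfold outer
  rw [aux_star_vec, Matrix.trace_vecMulVec]
  simp only [dotProduct, aux_clusterVec]
  have hs : ((1 / Real.sqrt 2 : ℝ) : ℂ) * ((1 / Real.sqrt 2 : ℝ) : ℂ) = 1 / 2 := by
    rw [← Complex.ofReal_mul, div_mul_div_comm, Real.mul_self_sqrt (by norm_num)]
    norm_num
  have : ∀ v, auxSign M v * ((1 / Real.sqrt 2 : ℝ) : ℂ) ^ (M + 1) *
      (auxSign M v * ((1 / Real.sqrt 2 : ℝ) : ℂ) ^ (M + 1)) = (1 / 2) ^ (M + 1) := by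
    intro v
    rw [mul_mul_mul_comm, aux_sign_sq, one_mul, ← mul_pow, hs]
  simp only [this]
  simp

theorem aux_outer_fix (M : ℕ) (m : Fin (M + 1)) :
    outer (M + 1) (clusterVec (M + 1)) * clS (M + 1) m = outer (M + 1) (clusterVec (M + 1)) := by
  unfold outer
  rw [aux_star_vec, Matrix.vecMulVec_mul, aux_vec_fix]

theorem aux_inv_init (M : ℕ) : AuxInv M (outer (M + 2) (clusterVec (M + 2))) 1 1 := by
  refine ⟨fun m _ => aux_outer_fix (M + 1) m, aux_outer_trace (M + 1), ?_, ?_⟩ <;>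
    rw [aux_outer_fix (M + 1), aux_outer_trace (M + 1)] <;> simp

theorem aux_factor (e : ℝ) (h0 : 0 < e) (h1 : e < 1) :
    1 - e ^ 2 / 2 ≤ (1 + Real.sqrt (1 - e ^ 2)) / 2 := by
  have : 1 - e ^ 2 ≤ Real.sqrt (1 - e ^ 2) := by
    apply Real.le_sqrt_of_sq_le
    have h2 : e ^ 2 ≤ 1 := by nlinarith
    nlinarith [sq_nonneg e]
  linarith

theorem cluster_arbitrarily_many_sequential_detections
    (N : ℕ) (hN : 3 ≤ N) (n : ℕ) :
    ∃ lam : ℕ → ℝ,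
      (∀ k, 1 ≤ k → k ≤ n → lam k ∈ Set.Ioo (0 : ℝ) 1) ∧
      ∀ ρ : ℕ → QM N,
        ρ 1 = outer N (clusterVec N) →
        (∀ k, 2 ≤ k → k ≤ n →
          ρ k = phiMap N ⟨N - 1, by omega⟩ (lam (k - 1)) (ρ (k - 1))) →
        ∀ k, 1 ≤ k → k ≤ n → ((clWitnessMod N (lam k) * ρ k).trace).re < 0 := by
  obtain ⟨M, rfl⟩ : ∃ M, N = M + 2 := ⟨N - 2, by omega⟩
  set e : ℝ := 1 / (2 ^ n * (n + 1) + 1) with he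
  have hD : (0 : ℝ) < 2 ^ n * (n + 1) := by positivity
  have e0 : 0 < e := by positivity
  have e1 : e < 1 := by rw [he, div_lt_one (by positivity)]; linarith
  have eD : 2 ^ n * (n + 1) * e < 1 := by
    rw [he, mul_one_div, div_lt_one (by positivity)]; linarith
  refine ⟨fun _ => e, fun _ _ _ => ⟨e0, e1⟩, ?_⟩
  intro ρ h1 hs
  have inv : ∀ k, k + 1 ≤ n → AuxInv M (ρ (k + 1)) (((1 + Real.sqrt (1 - e ^ 2)) / 2) ^ k)
      (1 / 2 ^ k) := by
    intro k
    induction k with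
    | zero => intro _; rw [zero_add, h1]; simpa using aux_inv_init M
    | succ k ih =>
      intro hk
      have := aux_inv_step M _ _ _ e (ih (by omega))
      rw [hs (k + 1 + 1) (by omega) hk]
      have hq : (1 : ℝ) / 2 ^ (k + 1) = 1 / 2 ^ k / 2 := by rw [pow_succ, div_div]
      rw [pow_succ' ((1 + Real.sqrt (1 - e ^ 2)) / 2) k, hq]
      exact this
  intro k hk1 hk
  obtain ⟨k, rfl⟩ : ∃ j, k = j + 1 := ⟨k - 1, by omega⟩
  rw [aux_witness M _ _ _ _ (inv k hk), Complex.ofReal_re]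
  have b1 := aux_factor e e0 e1
  have b2 : 1 - (k : ℝ) * (e ^ 2 / 2) ≤ ((1 + Real.sqrt (1 - e ^ 2)) / 2) ^ k := by
    have h := one_add_mul_le_pow (a := -(e ^ 2 / 2)) (by nlinarith) k
    have hh : (1 + -(e ^ 2 / 2)) ^ k ≤ ((1 + Real.sqrt (1 - e ^ 2)) / 2) ^ k := by
      apply pow_le_pow_left₀
      · nlinarith
      · linarith
    linarith
  have hkn : (k : ℝ) ≤ n := by exact_mod_cast (by omega : k ≤ n)
  have hp : (2 : ℝ) ^ k ≤ 2 ^ n := pow_le_pow_right₀ (by norm_num) (by omega)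
  have b3 : (k : ℝ) * (e ^ 2 / 2) < e * (1 / 2 ^ k) := by
    rw [mul_one_div, lt_div_iff₀ (by positivity)]
    have : (2 : ℝ) ^ k * k * e < 1 := by
      refine lt_of_le_of_lt ?_ eD
      gcongr
      linarith
    have hnn : (0 : ℝ) ≤ 2 ^ k * k * e := by positivity
    nlinarith
  linarith

end
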